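/- arXiv:0804.4774 — 4 statements merged into one kernel-verified Lean document; each statement's English description precedes it below -/
import Mathlib

section
/- (New 4-variable non-Shannon-type inequality obtained by projecting the 7-variable cone H₇ ∩ C₇.) For any four jointly distributed discrete random variables X₁, X₂, X₃, X₄ with finite entropies: −28·H(1) − H(2) − 10·H(3) − 2·H(4) + 22·H(12) + 34·H(13) + 11·H(23) + 13·H(14) − 4·H(24) + 6·H(34) − 28·H(123) − 13·H(134) ≥ 0. -/
open MeasureTheory

/-- The Shannon entropy of a random variable `X` taking values in a finite set,
computed from the distribution of `X` under the measure `μ`. -/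
noncomputable def shannonEntropy {Ω : Type*} [MeasurableSpace Ω] (μ : Measure Ω)
    {β : Type*} [Fintype β] (X : Ω → β) : ℝ :=
  ∑ b : β, Real.negMulLog ((μ (X ⁻¹' {b})).toReal)

universe u

open scoped Classical in
/-- The mass, under the weight `p`, of the class of `i` for the equivalence relation `r`. -/
noncomputable def classMass {ι : Type*} [Fintype ι] (p : ι → ℝ) (r : Setoid ι) (i : ι) : ℝ :=
  ∑ j, if r i j then p j else 0

/-- The entropy of the partition of `ι` into the classes of `r`, under the weight `p`. -/
noncomputable def partitionEntropy {ι : Type*} [Fintype ι] (p : ι → ℝ) (r : Setoid ι) : ℝ :=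
  -∑ i, p i * Real.log (classMass p r i)

section PartitionEntropy

variable {ι κ : Type*} [Fintype ι] [Fintype κ] {p : ι → ℝ}

lemma classMass_congr (p : ι → ℝ) {r : Setoid ι} {i j : ι} (h : r i j) :
    classMass p r i = classMass p r j := by
  unfold classMass
  refine Finset.sum_congr rfl fun k _ => ?_
  have : r i k ↔ r j k := ⟨fun hk => r.trans (r.symm h) hk, fun hk => r.trans h hk⟩
  classical
  exact if_congr this rfl rfl

lemma le_classMass (hp : ∀ i, 0 ≤ p i) (r : Setoid ι) (i : ι) : p i ≤ classMass p r i := by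
  classical
  have := Finset.single_le_sum (f := fun j => if r i j then p j else 0)
    (fun j _ => by split_ifs <;> simp [hp]) (Finset.mem_univ i)
  simpa [classMass, r.refl i] using this

lemma classMass_nonneg (hp : ∀ i, 0 ≤ p i) (r : Setoid ι) (i : ι) : 0 ≤ classMass p r i :=
  (hp i).trans (le_classMass hp r i)

/-- The sum over a class of the weights divided by the mass of the class is at most one. -/
lemma sum_class_div_classMass_le_one (hp : ∀ i, 0 ≤ p i) (r : Setoid ι) (P : ι → Prop)
    [DecidablePred P] (hP : ∀ i j, P i → P j → r i j) :
    ∑ i, (if P i then p i / classMass p r i else 0) ≤ 1 := by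
  classical
  by_cases h : ∃ i₀, P i₀
  · obtain ⟨i₀, hi₀⟩ := h
    calc ∑ i, (if P i then p i / classMass p r i else 0)
        ≤ ∑ i, (if r i₀ i then p i else 0) / classMass p r i₀ := by
          refine Finset.sum_le_sum fun i _ => ?_
          have h1 := classMass_nonneg hp r i₀
          split_ifs with hi hr hr
          · rw [classMass_congr p hr]
          · exact absurd (hP _ _ hi₀ hi) hr
          · exact div_nonneg (hp i) h1
          · simp
      _ = classMass p r i₀ / classMass p r i₀ := by rw [← Finset.sum_div]; rfl
      _ ≤ 1 := div_self_le_one _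
  · push Not at h
    simp [h]

/-- Submodularity of entropy. -/
lemma partitionEntropy_submodular (hp : ∀ i, 0 ≤ p i) (hp1 : ∑ i, p i = 1)
    {r s t : Setoid ι} (hr : r ≤ t) (hs : s ≤ t) :
    partitionEntropy p (r ⊓ s) + partitionEntropy p t ≤
      partitionEntropy p r + partitionEntropy p s := by
  classical
  have hkey : ∑ i, p i * (classMass p r i * classMass p s i /
      (classMass p (r ⊓ s) i * classMass p t i)) ≤ 1 := by
    have hexp : ∀ i, p i * (classMass p r i * classMass p s i /
        (classMass p (r ⊓ s) i * classMass p t i)) =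
        ∑ j, ∑ k, p j * (if t j k then p k / classMass p t j else 0) *
          (if r i j ∧ s i k then p i / classMass p (r ⊓ s) i else 0) := by
      intro i
      have hmul : classMass p r i * classMass p s i =
          ∑ j, ∑ k, (if r i j then p j else 0) * (if s i k then p k else 0) := by
        rw [classMass, classMass, Finset.sum_mul_sum]
      rw [hmul, Finset.sum_div, Finset.mul_sum]
      refine Finset.sum_congr rfl fun j _ => ?_
      rw [Finset.sum_div, Finset.mul_sum]
      refine Finset.sum_congr rfl fun k _ => ?_
      by_cases h1 : r i j
      · by_cases h2 : s i k
        · have h3 : t j k := t.trans (t.symm (hr h1)) (hs h2)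
          simp only [h1, h2, h3, and_self, if_true, classMass_congr p (hr h1), div_eq_mul_inv,
            mul_inv]
          ring
        · simp [h2]
      · simp [h1]
    simp_rw [hexp]
    rw [Finset.sum_comm]
    calc ∑ j, ∑ i, ∑ k, p j * (if t j k then p k / classMass p t j else 0) *
          (if r i j ∧ s i k then p i / classMass p (r ⊓ s) i else 0)
        = ∑ j, ∑ k, p j * (if t j k then p k / classMass p t j else 0) *
          ∑ i, (if r i j ∧ s i k then p i / classMass p (r ⊓ s) i else 0) := by
          refine Finset.sum_congr rfl fun j _ => ?_
          rw [Finset.sum_comm]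
          simp_rw [Finset.mul_sum]
      _ ≤ ∑ j, ∑ k, p j * (if t j k then p k / classMass p t j else 0) * 1 := by
          refine Finset.sum_le_sum fun j _ => Finset.sum_le_sum fun k _ => ?_
          refine mul_le_mul_of_nonneg_left ?_ ?_
          · refine sum_class_div_classMass_le_one hp (r ⊓ s) _ fun a b ha hb => ?_
            exact ⟨r.trans ha.1 (r.symm hb.1), s.trans ha.2 (s.symm hb.2)⟩
          · have h1 := classMass_nonneg hp t j
            have h2 := hp k
            have h3 := hp j
            split_ifs <;> positivity
      _ ≤ ∑ j, p j := by
          refine Finset.sum_le_sum fun j _ => ?_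
          simp_rw [mul_one]
          rw [← Finset.mul_sum]
          refine mul_le_of_le_one_right (hp j) ?_
          have : ∑ k, (if t j k then p k / classMass p t j else 0) =
              classMass p t j / classMass p t j := by
            nth_rewrite 2 [classMass]
            rw [Finset.sum_div]
            refine Finset.sum_congr rfl fun k _ => ?_
            split_ifs <;> simp
          rw [this]
          exact div_self_le_one _
      _ = 1 := hp1
  have hlog : ∀ i, p i * (Real.log (classMass p r i) + Real.log (classMass p s i)
      - Real.log (classMass p (r ⊓ s) i) - Real.log (classMass p t i)) ≤
      p i * (classMass p r i * classMass p s i /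
        (classMass p (r ⊓ s) i * classMass p t i)) - p i := by
    intro i
    rcases (hp i).eq_or_lt with h0 | h0
    · simp [← h0]
    · have hpos : ∀ r : Setoid ι, 0 < classMass p r i := fun r =>
        h0.trans_le (le_classMass hp r i)
      have h1 := hpos r
      have h2 := hpos s
      have h3 := hpos (r ⊓ s)
      have h4 := hpos t
      have := Real.log_le_sub_one_of_pos (div_pos (mul_pos h1 h2) (mul_pos h3 h4))
      rw [Real.log_div (by positivity) (by positivity), Real.log_mul h1.ne' h2.ne',
        Real.log_mul h3.ne' h4.ne'] at this
      nlinarith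
  have hsum := Finset.sum_le_sum fun i (_ : i ∈ Finset.univ) => hlog i
  simp only [mul_sub, mul_add, Finset.sum_sub_distrib, Finset.sum_add_distrib] at hsum
  unfold partitionEntropy
  linarith

/-- Two partitions that agree up to null sets have the same entropy. -/
lemma partitionEntropy_congr {r s : Setoid ι}
    (h : ∀ i j, p i ≠ 0 → p j ≠ 0 → (r i j ↔ s i j)) :
    partitionEntropy p r = partitionEntropy p s := by
  classical
  unfold partitionEntropy
  congr 1
  refine Finset.sum_congr rfl fun i _ => ?_
  by_cases hi : p i = 0
  · simp [hi]
  · congr 2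
    refine Finset.sum_congr rfl fun j _ => ?_
    by_cases hj : p j = 0
    · simp [hj]
    · simp only [h i j hi hj]

/-- Change of variables along a map that sends the weight `q` to the weight `p`. -/
lemma sum_mul_comp_of_map [DecidableEq ι] (φ : κ → ι) {q : κ → ℝ}
    (hq : ∀ i, ∑ x, (if φ x = i then q x else 0) = p i) (F : ι → ℝ) :
    ∑ x, q x * F (φ x) = ∑ i, p i * F i := by
  simp_rw [← hq, Finset.sum_mul]
  rw [Finset.sum_comm]
  refine Finset.sum_congr rfl fun x _ => ?_
  simp [ite_mul]

/-- The entropy of a partition pulled back along a map is its entropy for the image weight. -/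
lemma partitionEntropy_comap [DecidableEq ι] (φ : κ → ι) {q : κ → ℝ}
    (hq : ∀ i, ∑ x, (if φ x = i then q x else 0) = p i) (r : Setoid ι) :
    partitionEntropy q (r.comap φ) = partitionEntropy p r := by
  classical
  have hmass : ∀ x, classMass q (r.comap φ) x = classMass p r (φ x) := by
    intro x
    have := sum_mul_comp_of_map φ hq fun j => if r (φ x) j then 1 else 0
    simpa [classMass, Setoid.comap_rel] using this
  unfold partitionEntropy
  simp_rw [hmass]
  rw [sum_mul_comp_of_map φ hq fun i => Real.log (classMass p r i)]

/-- The weight on pairs obtained by sampling two points independently conditionally on their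
common class for `z`. -/
noncomputable def fiberWeight (p : ι → ℝ) (z : Setoid ι) (x : ι × ι) : ℝ :=
  open scoped Classical in if z x.1 x.2 then p x.1 * p x.2 / classMass p z x.1 else 0

lemma fiberWeight_nonneg (hp : ∀ i, 0 ≤ p i) (z : Setoid ι) (x : ι × ι) :
    0 ≤ fiberWeight p z x := by
  unfold fiberWeight
  split_ifs
  · exact div_nonneg (mul_nonneg (hp _) (hp _)) (classMass_nonneg hp _ _)
  · exact le_rfl

lemma rel_of_fiberWeight_ne_zero {z : Setoid ι} {x : ι × ι} (h : fiberWeight p z x ≠ 0) :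
    z x.1 x.2 := by
  by_contra hz
  exact h (by simp [fiberWeight, hz])

lemma sum_fiberWeight_right (hp : ∀ i, 0 ≤ p i) (z : Setoid ι) (i : ι) :
    ∑ j, fiberWeight p z (i, j) = p i := by
  classical
  have h1 : ∑ j, fiberWeight p z (i, j) = p i * classMass p z i / classMass p z i := by
    nth_rewrite 1 [classMass]
    rw [Finset.mul_sum, Finset.sum_div]
    refine Finset.sum_congr rfl fun j _ => ?_
    simp only [fiberWeight]
    split_ifs <;> simp
  rw [h1]
  rcases (hp i).eq_or_lt with h0 | h0
  · simp [← h0]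
  · exact mul_div_cancel_right₀ _ (h0.trans_le (le_classMass hp z i)).ne'

lemma fiberWeight_swap (p : ι → ℝ) (z : Setoid ι) (i j : ι) :
    fiberWeight p z (i, j) = fiberWeight p z (j, i) := by
  unfold fiberWeight
  by_cases h : z i j
  · simp only [h, z.symm h, if_true, classMass_congr p h, mul_comm]
  · have h' : ¬ z j i := fun h' => h (z.symm h')
    simp only [h, h', if_false]

lemma sum_fiberWeight_fst [DecidableEq ι] (hp : ∀ i, 0 ≤ p i) (z : Setoid ι) (i : ι) :
    ∑ x : ι × ι, (if x.1 = i then fiberWeight p z x else 0) = p i := by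
  rw [Fintype.sum_prod_type_right]
  simpa using sum_fiberWeight_right hp z i

lemma sum_fiberWeight_snd [DecidableEq ι] (hp : ∀ i, 0 ≤ p i) (z : Setoid ι) (i : ι) :
    ∑ x : ι × ι, (if x.2 = i then fiberWeight p z x else 0) = p i := by
  rw [Fintype.sum_prod_type]
  simpa [fiberWeight_swap p z _ i] using sum_fiberWeight_right hp z i

/-- Conditional independence of the two points sampled by `fiberWeight`. -/
lemma partitionEntropy_fiberWeight (hp : ∀ i, 0 ≤ p i) {r s z : Setoid ι} (hr : r ≤ z) :
    partitionEntropy (fiberWeight p z) (r.comap Prod.fst ⊓ s.comap Prod.snd) +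
      partitionEntropy p z = partitionEntropy p r + partitionEntropy p (s ⊓ z) := by
  classical
  have hmass : ∀ x : ι × ι, z x.1 x.2 →
      classMass (fiberWeight p z) (r.comap Prod.fst ⊓ s.comap Prod.snd) x =
        classMass p r x.1 * classMass p (s ⊓ z) x.2 / classMass p z x.1 := by
    rintro ⟨i, j⟩ hij
    simp only at hij
    have hprod : classMass p r i * classMass p (s ⊓ z) j =
        ∑ a, ∑ b, (if r i a then p a else 0) * (if (s ⊓ z) j b then p b else 0) := by
      rw [classMass, classMass, Finset.sum_mul_sum]
    rw [hprod, classMass, Fintype.sum_prod_type, Finset.sum_div]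
    refine Finset.sum_congr rfl fun a _ => ?_
    rw [Finset.sum_div]
    refine Finset.sum_congr rfl fun b _ => ?_
    have hl : (r.comap Prod.fst ⊓ s.comap Prod.snd) (i, j) (a, b) ↔ r i a ∧ s j b := Iff.rfl
    have hr' : (s ⊓ z) j b ↔ s j b ∧ z j b := Iff.rfl
    simp only [hl, hr']
    by_cases h1 : r i a
    · have h2 : z a b ↔ z j b :=
        ⟨fun h => z.trans (z.symm hij) (z.trans (hr h1) h),
          fun h => z.trans (z.symm (hr h1)) (z.trans hij h)⟩
      by_cases h3 : s j b
      · by_cases h4 : z j b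
        · simp [h1, h3, h4, fiberWeight, h2, classMass_congr p (hr h1)]
        · simp [h1, h3, h4, fiberWeight, h2]
      · simp [h3]
    · simp [h1]
  have hterm : ∀ x : ι × ι, fiberWeight p z x *
      Real.log (classMass (fiberWeight p z) (r.comap Prod.fst ⊓ s.comap Prod.snd) x) =
      fiberWeight p z x * Real.log (classMass p r x.1)
      + fiberWeight p z x * Real.log (classMass p (s ⊓ z) x.2)
      - fiberWeight p z x * Real.log (classMass p z x.1) := by
    intro x
    by_cases hx : fiberWeight p z x = 0
    · simp [hx]
    · have hz := rel_of_fiberWeight_ne_zero hx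
      have hx1 : p x.1 ≠ 0 := fun h => hx (by simp [fiberWeight, h])
      have hx2 : p x.2 ≠ 0 := fun h => hx (by simp [fiberWeight, h])
      have hpos : ∀ (t : Setoid ι) (i : ι), p i ≠ 0 → classMass p t i ≠ 0 := fun t i hi =>
        (((hp i).lt_of_ne' hi).trans_le (le_classMass hp t i)).ne'
      rw [hmass x hz, Real.log_div (mul_ne_zero (hpos _ _ hx1) (hpos _ _ hx2)) (hpos _ _ hx1),
        Real.log_mul (hpos _ _ hx1) (hpos _ _ hx2)]
      ring
  have hfst := sum_mul_comp_of_map Prod.fst (sum_fiberWeight_fst hp z)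
  have hsnd := sum_mul_comp_of_map Prod.snd (sum_fiberWeight_snd hp z)
  unfold partitionEntropy
  simp_rw [hterm]
  rw [Finset.sum_sub_distrib, Finset.sum_add_distrib, hfst fun i => Real.log (classMass p r i),
    hfst fun i => Real.log (classMass p z i), hsnd fun i => Real.log (classMass p (s ⊓ z) i)]
  ring

end PartitionEntropy

/-- The relation saying that two points have the same value of `X k` for all `k ∈ S`. -/
def agreeOn {ι : Type*} (X : ℕ → ι → ℕ) (S : Finset ℕ) : Setoid ι where
  r i j := ∀ k ∈ S, X k i = X k j
  iseqv := ⟨fun _ _ _ => rfl, fun h k hk => (h k hk).symm,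
    fun h h' k hk => (h k hk).trans (h' k hk)⟩

/-- `h` is the entropy function of a sequence of random variables on a finite probability space. -/
def IsEntropic (h : Finset ℕ → ℝ) : Prop :=
  ∃ (ι : Type u) (_ : Fintype ι) (p : ι → ℝ) (X : ℕ → ι → ℕ),
    (∀ i, 0 ≤ p i) ∧ ∑ i, p i = 1 ∧ ∀ S, h S = partitionEntropy p (agreeOn X S)

/-- Submodularity of entropy functions. -/
lemma IsEntropic.submodular {h : Finset ℕ → ℝ} (hh : IsEntropic.{u} h) (A B U V : Finset ℕ)
    (hU : A ∪ B = U) (hV : V ⊆ A ∩ B) : h U + h V ≤ h A + h B := by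
  obtain ⟨ι, _, p, X, hp, hp1, hX⟩ := hh
  have hUV : agreeOn X U = agreeOn X A ⊓ agreeOn X B := by
    ext i j
    subst hU
    exact ⟨fun H => ⟨fun k hk => H k (Finset.mem_union_left _ hk),
      fun k hk => H k (Finset.mem_union_right _ hk)⟩,
      fun H k hk => (Finset.mem_union.1 hk).elim (H.1 k) (H.2 k)⟩
  rw [hX, hX, hX, hX, hUV]
  refine partitionEntropy_submodular hp hp1 ?_ ?_
  · exact fun i j H k hk => H k (Finset.mem_inter.1 (hV hk)).1
  · exact fun i j H k hk => H k (Finset.mem_inter.1 (hV hk)).2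

/-- In the entropy function `h`, the variable `d` is a copy of the variable `c` over the variables
in `Z`: it has the same joint distribution with them, and is conditionally independent given them
of all the variables of index less than `d`. -/
structure IsCopy (h : Finset ℕ → ℝ) (Z : Finset ℕ) (c d : ℕ) : Prop where
  eq_of_subset : ∀ S ⊆ Z, h (insert d S) = h (insert c S)
  add_eq_add : ∀ S ⊆ Finset.range d, Z ⊆ S → h (insert d S) + h Z = h (insert c Z) + h S

lemma IsCopy.eq {h : Finset ℕ → ℝ} {Z : Finset ℕ} {c d : ℕ} (H : IsCopy h Z c d)
    (S T U : Finset ℕ) (hT : insert d S = T) (hU : insert c S = U) (hS : S ⊆ Z) : h T = h U := by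
  rw [← hT, ← hU, H.eq_of_subset S hS]

lemma IsCopy.add_eq {h : Finset ℕ → ℝ} {Z : Finset ℕ} {c d : ℕ} (H : IsCopy h Z c d)
    (S T U : Finset ℕ) (hT : insert d S = T) (hU : insert c Z = U) (hS : S ⊆ Finset.range d)
    (hZ : Z ⊆ S) : h T + h Z = h U + h S := by
  rw [← hT, ← hU, H.add_eq_add S hS hZ]

/-- The copy lemma. -/
lemma IsEntropic.exists_isCopy {h : Finset ℕ → ℝ} (hh : IsEntropic.{u} h) (Z : Finset ℕ) (c d : ℕ)
    (hZ : Z ⊆ Finset.range d) (hc : c < d) :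
    ∃ h', IsEntropic.{u} h' ∧ (∀ S ⊆ Finset.range d, h' S = h S) ∧ IsCopy h' Z c d := by
  classical
  obtain ⟨ι, _, p, X, hp, hp1, hX⟩ := hh
  let z := agreeOn X Z
  let Y : ℕ → ι × ι → ℕ := fun k x => if k = d then X c x.2 else X k x.1
  have hYd : ∀ x, Y d x = X c x.2 := fun x => if_pos rfl
  have hYk : ∀ k x, k < d → Y k x = X k x.1 := fun k x hk => if_neg hk.ne
  have hfst := partitionEntropy_comap Prod.fst (sum_fiberWeight_fst hp z)
  have hsnd := partitionEntropy_comap Prod.snd (sum_fiberWeight_snd hp z)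
  have hold : ∀ S ⊆ Finset.range d, agreeOn Y S = (agreeOn X S).comap Prod.fst := by
    intro S hS
    ext x y
    refine forall₂_congr fun k hk => ?_
    rw [hYk k x (Finset.mem_range.1 (hS hk)), hYk k y (Finset.mem_range.1 (hS hk))]
  have hins : ∀ S ⊆ Finset.range d, agreeOn Y (insert d S) =
      (agreeOn X S).comap Prod.fst ⊓ (agreeOn X {c}).comap Prod.snd := by
    intro S hS
    ext x y
    have h1 : agreeOn Y (insert d S) x y ↔ Y d x = Y d y ∧ agreeOn Y S x y :=
      Finset.forall_mem_insert _ _ _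
    have h2 : (agreeOn X {c}).comap Prod.snd x y ↔ X c x.2 = X c y.2 := by
      change (∀ k ∈ ({c} : Finset ℕ), _) ↔ _
      simp
    rw [h1, hold S hS, hYd, hYd, ← h2]
    exact and_comm
  have hXins : ∀ S, agreeOn X (insert c S) = agreeOn X {c} ⊓ agreeOn X S := by
    intro S
    ext i j
    have h2 : agreeOn X {c} i j ↔ X c i = X c j := by
      change (∀ k ∈ ({c} : Finset ℕ), _) ↔ _
      simp
    change (∀ k ∈ insert c S, _) ↔ agreeOn X {c} i j ∧ agreeOn X S i j
    rw [Finset.forall_mem_insert, h2]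
    exact Iff.rfl
  have hsub : ∀ S ⊆ Finset.range d,
      partitionEntropy (fiberWeight p z) (agreeOn Y S) = partitionEntropy p (agreeOn X S) :=
    fun S hS => by rw [hold S hS, hfst]
  refine ⟨fun S => partitionEntropy (fiberWeight p z) (agreeOn Y S),
    ⟨ι × ι, inferInstance, fiberWeight p z, Y, fiberWeight_nonneg hp z, ?_, fun S => rfl⟩,
    fun S hS => (hsub S hS).trans (hX S).symm, ?_, ?_⟩
  · rw [Fintype.sum_prod_type]
    simp_rw [sum_fiberWeight_right hp z]
    exact hp1
  · intro S hS
    have hcS : insert c S ⊆ Finset.range d :=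
      Finset.insert_subset (Finset.mem_range.2 hc) (hS.trans hZ)
    rw [hsub _ hcS, ← hsnd, hXins, hins S (hS.trans hZ)]
    refine partitionEntropy_congr fun x y hx hy => ?_
    have hxz := rel_of_fiberWeight_ne_zero hx
    have hyz := rel_of_fiberWeight_ne_zero hy
    have hS' : agreeOn X S x.1 y.1 ↔ agreeOn X S x.2 y.2 :=
      forall₂_congr fun k hk => by rw [hxz k (hS hk), hyz k (hS hk)]
    change agreeOn X S x.1 y.1 ∧ agreeOn X {c} x.2 y.2 ↔
      agreeOn X {c} x.2 y.2 ∧ agreeOn X S x.2 y.2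
    rw [hS', and_comm]
  · intro S hS hZS
    rw [hsub Z hZ, hsub _ (Finset.insert_subset (Finset.mem_range.2 hc) hZ), hsub S hS, hins S hS,
      hXins]
    refine (partitionEntropy_fiberWeight hp ?_).trans (add_comm _ _)
    exact fun i j H k hk => H k (hZS hk)

lemma IsCopy.congr {h h' : Finset ℕ → ℝ} {Z : Finset ℕ} {c d n : ℕ} (H : IsCopy h Z c d)
    (hn : ∀ S ⊆ Finset.range n, h' S = h S) (hZ : Z ⊆ Finset.range d) (hc : c < d) (hd : d < n) :
    IsCopy h' Z c d := by
  have hdn : Finset.range d ⊆ Finset.range n := Finset.range_subset_range.2 hd.le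
  have hins : ∀ k ≤ d, ∀ S ⊆ Finset.range d, h' (insert k S) = h (insert k S) :=
    fun k hk S hS => hn _ (Finset.insert_subset (Finset.mem_range.2 (hk.trans_lt hd))
      (hS.trans hdn))
  refine ⟨fun S hS => ?_, fun S hS hZS => ?_⟩
  · rw [hins d le_rfl S (hS.trans hZ), hins c hc.le S (hS.trans hZ), H.eq_of_subset S hS]
  · rw [hins d le_rfl S hS, hins c hc.le Z hZ, hn Z (hZ.trans hdn), hn S (hS.trans hdn),
      H.add_eq_add S hS hZS]

/-- The Shannon entropy of a function of a finite-valued random variable, as the entropy of a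
partition of the set of values. -/
lemma shannonEntropy_comp {Ω : Type*} [MeasurableSpace Ω] (μ : Measure Ω) [IsFiniteMeasure μ]
    {ι β : Type*} [Fintype ι] [Fintype β] [MeasurableSpace ι] [MeasurableSingletonClass ι]
    {Y : Ω → ι} (hY : Measurable Y) (f : ι → β) :
    shannonEntropy μ (fun ω => f (Y ω)) =
      partitionEntropy (fun i => μ.real (Y ⁻¹' {i})) (Setoid.ker f) := by
  classical
  set p : ι → ℝ := fun i => μ.real (Y ⁻¹' {i}) with hp
  have hmass : ∀ b, (μ ((fun ω => f (Y ω)) ⁻¹' {b})).toReal = ∑ i with f i = b, p i := by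
    intro b
    rw [hp, sum_measureReal_preimage_singleton _ fun i _ => hY (measurableSet_singleton i)]
    congr 2
    ext ω
    simp
  have hclass : ∀ i, classMass p (Setoid.ker f) i = ∑ j with f j = f i, p j := by
    intro i
    rw [classMass, Finset.sum_filter]
    exact Finset.sum_congr rfl fun j _ => if_congr eq_comm rfl rfl
  unfold shannonEntropy partitionEntropy
  simp_rw [hmass, hclass, Real.negMulLog, neg_mul, Finset.sum_neg_distrib]
  rw [← Finset.sum_fiberwise Finset.univ f fun i => p i * Real.log (∑ j with f j = f i, p j)]
  congr 1
  refine Finset.sum_congr rfl fun b _ => ?_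
  rw [Finset.sum_mul]
  refine Finset.sum_congr rfl fun i hi => ?_
  rw [(Finset.mem_filter.1 hi).2]

/-- The Shannon entropy of a function of a finite-valued random variable `Y`, when the function
determines and is determined by a given set of functions of `Y`. -/
lemma shannonEntropy_comp_eq_agreeOn {Ω : Type*} [MeasurableSpace Ω] (μ : Measure Ω)
    [IsFiniteMeasure μ] {ι β : Type*} [Fintype ι] [Fintype β] [MeasurableSpace ι]
    [MeasurableSingletonClass ι] {Y : Ω → ι} (hY : Measurable Y) (X : ℕ → ι → ℕ) (f : ι → β)
    (S : Finset ℕ) (hS : ∀ i j, f i = f j ↔ ∀ k ∈ S, X k i = X k j) :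
    shannonEntropy μ (fun ω => f (Y ω)) =
      partitionEntropy (fun i => μ.real (Y ⁻¹' {i})) (agreeOn X S) := by
  rw [shannonEntropy_comp μ hY f]
  congr 1
  ext i j
  exact hS i j

/-- The inequality for an entropy function with a copy of variable 2 over 0 and 1, followed by
a second copy of variable 2 and a copy of variable 1. -/
lemma IsEntropic.inequality_of_isCopy {h : Finset ℕ → ℝ} (hh : IsEntropic.{u} h)
    (h4 : IsCopy h {0, 1} 2 4) (h5 : IsCopy h {0, 3, 4} 2 5) (h6 : IsCopy h {0, 2, 4, 5} 1 6) :
    0 ≤ -28 * h {0} - h {1} - 10 * h {2} - 2 * h {3} + 22 * h {0, 1} + 34 * h {0, 2}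
      + 11 * h {1, 2} + 13 * h {0, 3} - 4 * h {1, 3} + 6 * h {2, 3}
      - 28 * h {0, 1, 2} - 13 * h {0, 2, 3} := by
  linarith [
    hh.submodular {0, 1, 2, 3, 4} {0, 1, 2, 4, 5} {0, 1, 2, 3, 4, 5} {0, 1, 2, 4}
      (by decide) (by decide),
    hh.submodular {0, 1, 3} {1, 3, 4} {0, 1, 3, 4} {1, 3} (by decide) (by decide),
    hh.submodular {0, 2, 4, 5, 6} {1, 2, 4, 5, 6} {0, 1, 2, 4, 5, 6} {2, 4, 5, 6}
      (by decide) (by decide),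
    hh.submodular {0, 3} {0, 4} {0, 3, 4} {0} (by decide) (by decide),
    hh.submodular {1, 6} {3, 6} {1, 3, 6} {6} (by decide) (by decide),
    hh.submodular {2, 3, 5} {2, 4, 5} {2, 3, 4, 5} {2, 5} (by decide) (by decide),
    hh.submodular {1, 5, 6} {3, 5, 6} {1, 3, 5, 6} {5, 6} (by decide) (by decide),
    hh.submodular {1, 4, 5} {4, 5, 6} {1, 4, 5, 6} {4, 5} (by decide) (by decide),
    hh.submodular {0, 1, 2, 3} {0, 2, 3, 4} {0, 1, 2, 3, 4} {0, 2, 3} (by decide) (by decide),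
    hh.submodular {0, 2, 4} {1, 2, 4} {0, 1, 2, 4} {2, 4} (by decide) (by decide),
    hh.submodular {0, 2, 3, 4} {0, 2, 3, 6} {0, 2, 3, 4, 6} {0, 2, 3} (by decide) (by decide),
    hh.submodular {1, 2, 5, 6} {1, 4, 5, 6} {1, 2, 4, 5, 6} {1, 5, 6} (by decide) (by decide),
    hh.submodular {0, 2, 4, 5} {1, 2, 4, 5} {0, 1, 2, 4, 5} {2, 4, 5} (by decide) (by decide),
    hh.submodular {0, 3, 6} {2, 3, 6} {0, 2, 3, 6} {3, 6} (by decide) (by decide),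
    hh.submodular {0, 1, 3, 5, 6} {0, 3, 4, 5, 6} {0, 1, 3, 4, 5, 6} {0, 3, 5, 6}
      (by decide) (by decide),
    hh.submodular {1, 2, 5} {2, 5, 6} {1, 2, 5, 6} {2, 5} (by decide) (by decide),
    hh.submodular {2, 3} {3, 5} {2, 3, 5} {3} (by decide) (by decide),
    hh.submodular {0, 2} {0, 4} {0, 2, 4} {0} (by decide) (by decide),
    hh.submodular {1, 2, 4, 6} {2, 4, 5, 6} {1, 2, 4, 5, 6} {2, 4, 6} (by decide) (by decide),
    hh.submodular {1, 5} {3, 5} {1, 3, 5} {5} (by decide) (by decide),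
    hh.submodular {1, 2, 6} {1, 4, 6} {1, 2, 4, 6} {1, 6} (by decide) (by decide),
    hh.submodular {1, 3, 5} {1, 3, 6} {1, 3, 5, 6} {1, 3} (by decide) (by decide),
    hh.submodular {0, 2, 3, 4, 6} {0, 2, 4, 5, 6} {0, 2, 3, 4, 5, 6} {0, 2, 4, 6}
      (by decide) (by decide),
    hh.submodular {0, 1, 2, 3, 4, 5} {0, 1, 3, 4, 5, 6} {0, 1, 2, 3, 4, 5, 6} {0, 1, 3, 4, 5}
      (by decide) (by decide),
    hh.submodular {2, 3} {2, 6} {2, 3, 6} {2} (by decide) (by decide),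
    hh.submodular {0, 3, 4} {2, 3, 4} {0, 2, 3, 4} {3, 4} (by decide) (by decide),
    hh.submodular {1, 2} {2, 6} {1, 2, 6} {2} (by decide) (by decide),
    hh.submodular {1, 2} {2, 5} {1, 2, 5} {2} (by decide) (by decide),
    hh.submodular {0, 3, 4, 5} {2, 3, 4, 5} {0, 2, 3, 4, 5} {3, 4, 5} (by decide) (by decide),
    hh.submodular {3, 5} {3, 6} {3, 5, 6} {3} (by decide) (by decide),
    hh.submodular {1, 4} {4, 5} {1, 4, 5} {4} (by decide) (by decide),
    hh.submodular {1, 4} {4, 6} {1, 4, 6} {4} (by decide) (by decide),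
    hh.submodular {0, 3, 4, 5} {0, 3, 5, 6} {0, 3, 4, 5, 6} {0, 3, 5} (by decide) (by decide),
    hh.submodular {0, 3} {0, 6} {0, 3, 6} {0} (by decide) (by decide),
    hh.submodular {0, 1, 3, 5} {1, 3, 5, 6} {0, 1, 3, 5, 6} {1, 3, 5} (by decide) (by decide),
    hh.submodular {0, 2, 4} {0, 4, 5} {0, 2, 4, 5} {0, 4} (by decide) (by decide),
    hh.submodular {1, 4} {3, 4} {1, 3, 4} {4} (by decide) (by decide),
    hh.submodular {0, 1, 3} {1, 3, 5} {0, 1, 3, 5} {1, 3} (by decide) (by decide),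
    h4.add_eq {0, 1, 2, 3} {0, 1, 2, 3, 4} {0, 1, 2}
      (by decide) (by decide) (by decide) (by decide),
    h4.add_eq {0, 1, 2} {0, 1, 2, 4} {0, 1, 2} (by decide) (by decide) (by decide) (by decide),
    h4.add_eq {0, 1, 3} {0, 1, 3, 4} {0, 1, 2} (by decide) (by decide) (by decide) (by decide),
    h4.eq {0} {0, 4} {0, 2} (by decide) (by decide) (by decide),
    h4.eq {1} {1, 4} {1, 2} (by decide) (by decide) (by decide),
    h4.eq {} {4} {2} (by decide) (by decide) (by decide),
    h5.add_eq {0, 1, 2, 3, 4} {0, 1, 2, 3, 4, 5} {0, 2, 3, 4}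
      (by decide) (by decide) (by decide) (by decide),
    h5.add_eq {0, 1, 3, 4} {0, 1, 3, 4, 5} {0, 2, 3, 4}
      (by decide) (by decide) (by decide) (by decide),
    h5.add_eq {0, 2, 3, 4} {0, 2, 3, 4, 5} {0, 2, 3, 4}
      (by decide) (by decide) (by decide) (by decide),
    h5.eq {0, 3, 4} {0, 3, 4, 5} {0, 2, 3, 4} (by decide) (by decide) (by decide),
    h5.eq {0, 3} {0, 3, 5} {0, 2, 3} (by decide) (by decide) (by decide),
    h5.eq {0, 4} {0, 4, 5} {0, 2, 4} (by decide) (by decide) (by decide),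
    h5.eq {3, 4} {3, 4, 5} {2, 3, 4} (by decide) (by decide) (by decide),
    h5.eq {3} {3, 5} {2, 3} (by decide) (by decide) (by decide),
    h5.eq {4} {4, 5} {2, 4} (by decide) (by decide) (by decide),
    h5.eq {} {5} {2} (by decide) (by decide) (by decide),
    h6.add_eq {0, 1, 2, 3, 4, 5} {0, 1, 2, 3, 4, 5, 6} {0, 1, 2, 4, 5}
      (by decide) (by decide) (by decide) (by decide),
    h6.add_eq {0, 1, 2, 4, 5} {0, 1, 2, 4, 5, 6} {0, 1, 2, 4, 5}
      (by decide) (by decide) (by decide) (by decide),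
    h6.add_eq {0, 2, 3, 4, 5} {0, 2, 3, 4, 5, 6} {0, 1, 2, 4, 5}
      (by decide) (by decide) (by decide) (by decide),
    h6.eq {0, 2, 4, 5} {0, 2, 4, 5, 6} {0, 1, 2, 4, 5} (by decide) (by decide) (by decide),
    h6.eq {0, 2, 4} {0, 2, 4, 6} {0, 1, 2, 4} (by decide) (by decide) (by decide),
    h6.eq {0} {0, 6} {0, 1} (by decide) (by decide) (by decide),
    h6.eq {2, 4, 5} {2, 4, 5, 6} {1, 2, 4, 5} (by decide) (by decide) (by decide),
    h6.eq {2, 4} {2, 4, 6} {1, 2, 4} (by decide) (by decide) (by decide),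
    h6.eq {2, 5} {2, 5, 6} {1, 2, 5} (by decide) (by decide) (by decide),
    h6.eq {2} {2, 6} {1, 2} (by decide) (by decide) (by decide),
    h6.eq {4, 5} {4, 5, 6} {1, 4, 5} (by decide) (by decide) (by decide),
    h6.eq {4} {4, 6} {1, 4} (by decide) (by decide) (by decide),
    h6.eq {5} {5, 6} {1, 5} (by decide) (by decide) (by decide),
    h6.eq {} {6} {1} (by decide) (by decide) (by decide)]

/-- The inequality for entropy functions. -/
lemma IsEntropic.inequality {h : Finset ℕ → ℝ} (hh : IsEntropic.{u} h) :
    0 ≤ -28 * h {0} - h {1} - 10 * h {2} - 2 * h {3} + 22 * h {0, 1} + 34 * h {0, 2}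
      + 11 * h {1, 2} + 13 * h {0, 3} - 4 * h {1, 3} + 6 * h {2, 3}
      - 28 * h {0, 1, 2} - 13 * h {0, 2, 3} := by
  obtain ⟨f, hf, hfh, hf4⟩ := hh.exists_isCopy {0, 1} 2 4 (by decide) (by decide)
  obtain ⟨g, hg, hgf, hg5⟩ := hf.exists_isCopy {0, 3, 4} 2 5 (by decide) (by decide)
  obtain ⟨k, hk, hkg, hk6⟩ := hg.exists_isCopy {0, 2, 4, 5} 1 6 (by decide) (by decide)
  have hg4 := hf4.congr hgf (by decide) (by decide) (by decide)
  have hk4 := hg4.congr hkg (by decide) (by decide) (by decide)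
  have hk5 := hg5.congr hkg (by decide) (by decide) (by decide)
  have hkh : ∀ S ⊆ Finset.range 4, k S = h S := fun S hS => by
    rw [hkg S (hS.trans (by decide)), hgf S (hS.trans (by decide)), hfh S hS]
  have := hk.inequality_of_isCopy hk4 hk5 hk6
  rwa [hkh {0} (by decide), hkh {1} (by decide), hkh {2} (by decide), hkh {3} (by decide),
    hkh {0, 1} (by decide), hkh {0, 2} (by decide), hkh {1, 2} (by decide),
    hkh {0, 3} (by decide), hkh {1, 3} (by decide), hkh {2, 3} (by decide),
    hkh {0, 1, 2} (by decide), hkh {0, 2, 3} (by decide)] at this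

theorem new_inequality_from_H7_third
    {Ω : Type*} [MeasurableSpace Ω] (μ : Measure Ω) [IsProbabilityMeasure μ]
    {α₁ α₂ α₃ α₄ : Type*} [Fintype α₁] [Fintype α₂] [Fintype α₃] [Fintype α₄]
    [MeasurableSpace α₁] [MeasurableSpace α₂] [MeasurableSpace α₃] [MeasurableSpace α₄]
    [DiscreteMeasurableSpace α₁] [DiscreteMeasurableSpace α₂]
    [DiscreteMeasurableSpace α₃] [DiscreteMeasurableSpace α₄]
    (X₁ : Ω → α₁) (X₂ : Ω → α₂) (X₃ : Ω → α₃) (X₄ : Ω → α₄)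
    (hX₁ : Measurable X₁) (hX₂ : Measurable X₂) (hX₃ : Measurable X₃) (hX₄ : Measurable X₄) :
    -28 * shannonEntropy μ X₁
      - shannonEntropy μ X₂
      - 10 * shannonEntropy μ X₃
      - 2 * shannonEntropy μ X₄
      + 22 * shannonEntropy μ (fun ω => (X₁ ω, X₂ ω))
      + 34 * shannonEntropy μ (fun ω => (X₁ ω, X₃ ω))
      + 11 * shannonEntropy μ (fun ω => (X₂ ω, X₃ ω))
      + 13 * shannonEntropy μ (fun ω => (X₁ ω, X₄ ω))
      - 4 * shannonEntropy μ (fun ω => (X₂ ω, X₄ ω))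
      + 6 * shannonEntropy μ (fun ω => (X₃ ω, X₄ ω))
      - 28 * shannonEntropy μ (fun ω => (X₁ ω, X₂ ω, X₃ ω))
      - 13 * shannonEntropy μ (fun ω => (X₁ ω, X₃ ω, X₄ ω)) ≥ 0 := by
  let Y : Ω → α₁ × α₂ × α₃ × α₄ := fun ω => (X₁ ω, X₂ ω, X₃ ω, X₄ ω)
  have hY : Measurable Y := hX₁.prodMk (hX₂.prodMk (hX₃.prodMk hX₄))
  let X : ℕ → α₁ × α₂ × α₃ × α₄ → ℕ := fun k y =>
    match k with
    | 0 => Fintype.equivFin α₁ y.1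
    | 1 => Fintype.equivFin α₂ y.2.1
    | 2 => Fintype.equivFin α₃ y.2.2.1
    | 3 => Fintype.equivFin α₄ y.2.2.2
    | _ => 0
  let p : α₁ × α₂ × α₃ × α₄ → ℝ := fun y => μ.real (Y ⁻¹' {y})
  have hp1 : ∑ y, p y = 1 := by
    have := sum_measureReal_preimage_singleton (μ := μ) Finset.univ
      fun y _ => hY (measurableSet_singleton y)
    simpa [p] using this
  have hent : IsEntropic fun S => partitionEntropy p (agreeOn X S) :=
    ⟨_, inferInstance, p, X, fun _ => measureReal_nonneg, hp1, fun _ => rfl⟩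
  have hX0 : ∀ y y', X 0 y = X 0 y' ↔ y.1 = y'.1 := fun y y' => by simp [X, Fin.val_inj]
  have hX1 : ∀ y y', X 1 y = X 1 y' ↔ y.2.1 = y'.2.1 := fun y y' => by simp [X, Fin.val_inj]
  have hX2 : ∀ y y', X 2 y = X 2 y' ↔ y.2.2.1 = y'.2.2.1 := fun y y' => by
    simp [X, Fin.val_inj]
  have hX3 : ∀ y y', X 3 y = X 3 y' ↔ y.2.2.2 = y'.2.2.2 := fun y y' => by
    simp [X, Fin.val_inj]
  have e0 : shannonEntropy μ X₁ = partitionEntropy p (agreeOn X {0}) :=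
    shannonEntropy_comp_eq_agreeOn μ hY X (fun y => y.1) _
      fun y y' => by simp [hX0]
  have e1 : shannonEntropy μ X₂ = partitionEntropy p (agreeOn X {1}) :=
    shannonEntropy_comp_eq_agreeOn μ hY X (fun y => y.2.1) _
      fun y y' => by simp [hX1]
  have e2 : shannonEntropy μ X₃ = partitionEntropy p (agreeOn X {2}) :=
    shannonEntropy_comp_eq_agreeOn μ hY X (fun y => y.2.2.1) _
      fun y y' => by simp [hX2]
  have e3 : shannonEntropy μ X₄ = partitionEntropy p (agreeOn X {3}) :=
    shannonEntropy_comp_eq_agreeOn μ hY X (fun y => y.2.2.2) _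
      fun y y' => by simp [hX3]
  have e01 : shannonEntropy μ (fun ω => (X₁ ω, X₂ ω)) = partitionEntropy p (agreeOn X {0, 1}) :=
    shannonEntropy_comp_eq_agreeOn μ hY X (fun y => (y.1, y.2.1)) _
      fun y y' => by simp [hX0, hX1]
  have e02 : shannonEntropy μ (fun ω => (X₁ ω, X₃ ω)) = partitionEntropy p (agreeOn X {0, 2}) :=
    shannonEntropy_comp_eq_agreeOn μ hY X (fun y => (y.1, y.2.2.1)) _
      fun y y' => by simp [hX0, hX2]
  have e12 : shannonEntropy μ (fun ω => (X₂ ω, X₃ ω)) = partitionEntropy p (agreeOn X {1, 2}) :=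
    shannonEntropy_comp_eq_agreeOn μ hY X (fun y => (y.2.1, y.2.2.1)) _
      fun y y' => by simp [hX1, hX2]
  have e03 : shannonEntropy μ (fun ω => (X₁ ω, X₄ ω)) = partitionEntropy p (agreeOn X {0, 3}) :=
    shannonEntropy_comp_eq_agreeOn μ hY X (fun y => (y.1, y.2.2.2)) _
      fun y y' => by simp [hX0, hX3]
  have e13 : shannonEntropy μ (fun ω => (X₂ ω, X₄ ω)) = partitionEntropy p (agreeOn X {1, 3}) :=
    shannonEntropy_comp_eq_agreeOn μ hY X (fun y => (y.2.1, y.2.2.2)) _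
      fun y y' => by simp [hX1, hX3]
  have e23 : shannonEntropy μ (fun ω => (X₃ ω, X₄ ω)) = partitionEntropy p (agreeOn X {2, 3}) :=
    shannonEntropy_comp_eq_agreeOn μ hY X (fun y => (y.2.2.1, y.2.2.2)) _
      fun y y' => by simp [hX2, hX3, Prod.ext_iff]
  have e012 : shannonEntropy μ (fun ω => (X₁ ω, X₂ ω, X₃ ω)) =
      partitionEntropy p (agreeOn X {0, 1, 2}) :=
    shannonEntropy_comp_eq_agreeOn μ hY X (fun y => (y.1, y.2.1, y.2.2.1)) _
      fun y y' => by simp [hX0, hX1, hX2]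
  have e023 : shannonEntropy μ (fun ω => (X₁ ω, X₃ ω, X₄ ω)) =
      partitionEntropy p (agreeOn X {0, 2, 3}) :=
    shannonEntropy_comp_eq_agreeOn μ hY X (fun y => (y.1, y.2.2.1, y.2.2.2)) _
      fun y y' => by simp [hX0, hX2, hX3, Prod.ext_iff]
  rw [e0, e1, e2, e3, e01, e02, e12, e03, e13, e23, e012, e023]
  exact hent.inequality
end

section
/- (Copy lemma.) Let ξ = (ξ₁, …, ξₙ) be an n-dimensional discrete random vector taking values in finite sets, and let {k}, I, J be pairwise disjoint subsets of {1, …, n}. Then there exists a probability space carrying random variables (ζ₁, …, ζₙ, ζₙ₊₁) such that: (1) (ζ₁, …, ζₙ) has the same joint distribution as (ξ₁, …, ξₙ); (2) the joint distribution of (ζₙ₊₁, ζ_I) equals the joint distribution of (ζ_k, ζ_I); and (3) ζₙ₊₁ is conditionally independent of ζ_{{k} ∪ J} given ζ_I (the Markov chain ζ_{{k} ∪ J} → ζ_I → ζₙ₊₁ holds). Here ζ_S denotes the subvector (ζᵢ : i ∈ S). -/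
open MeasureTheory

open ProbabilityTheory in
/-- The law of `Y` given `X`, resampled independently of everything else given `X`. -/
noncomputable def condCopy {A B C : Type*} [MeasurableSpace A] [MeasurableSpace B]
    [MeasurableSpace C] [StandardBorelSpace C] [Nonempty C] (ν : Measure A) [IsFiniteMeasure ν]
    (X : A → B) (hX : Measurable X) (Y : A → C) : Measure (A × C) :=
  ν ⊗ₘ (condDistrib Y X ν).comap X hX

section CondCopy

open ProbabilityTheory

variable {A B C : Type*} [MeasurableSpace A] [MeasurableSpace B]
  [MeasurableSpace C] [StandardBorelSpace C] [Nonempty C] (ν : Measure A)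
  {X : A → B} (hX : Measurable X) {Y : A → C}

instance [IsProbabilityMeasure ν] : IsProbabilityMeasure (condCopy ν X hX Y) := by
  unfold condCopy; infer_instance

lemma map_fst_condCopy [IsFiniteMeasure ν] : (condCopy ν X hX Y).map Prod.fst = ν :=
  Measure.fst_compProd _ _

lemma condCopy_prod_of_subset_fiber [IsFiniteMeasure ν] {s : Set A} (hs : MeasurableSet s)
    {t : Set C} (ht : MeasurableSet t) {w : B} (hsw : ∀ a ∈ s, X a = w) :
    condCopy ν X hX Y (s ×ˢ t) = condDistrib Y X ν w t * ν s := by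
  rw [condCopy, Measure.compProd_apply_prod hs ht,
    setLIntegral_congr_fun (g := fun _ => condDistrib Y X ν w t) hs, setLIntegral_const]
  intro a ha
  simp [Kernel.comap_apply, hsw a ha]

lemma map_condCopy [IsFiniteMeasure ν] [Countable B] [MeasurableSingletonClass B] [Countable C]
    (hY : Measurable Y) :
    (condCopy ν X hX Y).map (fun p => (p.2, X p.1)) = ν.map (fun a => (Y a, X a)) := by
  refine Measure.ext_of_singleton fun ⟨y, w⟩ => ?_
  have hw : MeasurableSet (X ⁻¹' {w}) := hX (measurableSet_singleton w)
  rw [Measure.map_apply (by fun_prop) (measurableSet_singleton _),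
    Measure.map_apply (by fun_prop) (measurableSet_singleton _)]
  have h := condCopy_prod_of_subset_fiber ν hX (Y := Y) hw (measurableSet_singleton y)
    (w := w) (fun _ ha => ha)
  have h' := congrArg (fun m : Measure (B × C) => m ({w} ×ˢ {y}))
    (compProd_map_condDistrib (μ := ν) (X := X) (Y := Y) hY.aemeasurable)
  rw [Measure.compProd_apply_prod (measurableSet_singleton w) (measurableSet_singleton y),
    lintegral_singleton, Measure.map_apply hX (measurableSet_singleton w),
    Measure.map_apply (by fun_prop) (by measurability)] at h'
  convert h.trans h' using 2
  · ext; simp [and_comm]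
  · ext; simp [and_comm]

lemma condCopy_mul_eq [IsProbabilityMeasure ν] {s : Set A} (hs : MeasurableSet s)
    {t : Set C} (ht : MeasurableSet t) {w : B} (hw : MeasurableSet {w}) :
    condCopy ν X hX Y {p | p.2 ∈ t ∧ p.1 ∈ s ∧ X p.1 = w} * condCopy ν X hX Y {p | X p.1 = w}
      = condCopy ν X hX Y {p | p.2 ∈ t ∧ X p.1 = w}
        * condCopy ν X hX Y {p | p.1 ∈ s ∧ X p.1 = w} := by
  have key : ∀ s : Set A, MeasurableSet s → ∀ t : Set C, MeasurableSet t →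
      condCopy ν X hX Y {p | p.2 ∈ t ∧ p.1 ∈ s ∧ X p.1 = w}
        = condDistrib Y X ν w t * ν (s ∩ X ⁻¹' {w}) := fun s hs t ht => by
    rw [← condCopy_prod_of_subset_fiber ν hX (hs.inter (hX hw)) ht (fun _ ha => ha.2)]
    congr 1; ext; simp; tauto
  have h₁ := key Set.univ .univ Set.univ .univ
  have h₂ := key Set.univ .univ t ht
  have h₃ := key s hs Set.univ .univ
  simp only [Set.mem_univ, true_and, measure_univ, one_mul, Set.univ_inter] at h₁ h₂ h₃
  rw [key s hs t ht, h₁, h₂, h₃, mul_right_comm]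

end CondCopy

/-- The copy lemma: given a discrete random vector `ξ = (ξ₁, …, ξₙ)` with values in finite
sets and pairwise disjoint `{k}, I, J ⊆ {1, …, n}`, there is a probability space carrying
`(ζ₁, …, ζₙ)` with the same joint distribution as `ξ`, together with an extra random
variable `ζ'` (playing the role of `ζₙ₊₁`, a `ξ_J`-copy of `ξ_k` over `ξ_I`) such that
`(ζ', ζ_I)` is distributed as `(ζ_k, ζ_I)` and `ζ'` is conditionally independent of
`ζ_{{k} ∪ J}` given `ζ_I`. -/
theorem copy_lemma {n : ℕ} {Ω : Type*} [MeasurableSpace Ω] (μ : Measure Ω)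
    [IsProbabilityMeasure μ]
    (α : Fin n → Type) [∀ i, Fintype (α i)] [∀ i, MeasurableSpace (α i)]
    [∀ i, DiscreteMeasurableSpace (α i)]
    (ξ : ∀ i, Ω → α i) (hξ : ∀ i, Measurable (ξ i))
    (k : Fin n) (I J : Finset (Fin n)) (hkI : k ∉ I) (hkJ : k ∉ J) (hIJ : Disjoint I J) :
    ∃ (Ω' : Type) (_ : MeasurableSpace Ω') (μ' : Measure Ω') (_ : IsProbabilityMeasure μ')
      (ζ : ∀ i, Ω' → α i) (ζ' : Ω' → α k),
      (∀ i, Measurable (ζ i)) ∧ Measurable ζ' ∧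
      -- (1) (ζ₁, …, ζₙ) has the same joint distribution as (ξ₁, …, ξₙ)
      μ'.map (fun ω => fun i => ζ i ω) = μ.map (fun ω => fun i => ξ i ω) ∧
      -- (2) the joint distribution of (ζₙ₊₁, ζ_I) equals that of (ζ_k, ζ_I)
      μ'.map (fun ω => (ζ' ω, fun i : I => ζ i.1 ω))
        = μ'.map (fun ω => (ζ k ω, fun i : I => ζ i.1 ω)) ∧
      -- (3) the Markov chain ζ_{{k} ∪ J} → ζ_I → ζₙ₊₁ holds:
      -- P(ζ' = y, ζ_{{k}∪J} = z ∣ ζ_I = w) = P(ζ' = y ∣ ζ_I = w) ⬝ P(ζ_{{k}∪J} = z ∣ ζ_I = w)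
      -- whenever P(ζ_I = w) > 0 (stated multiplied through by P(ζ_I = w)²)
      (∀ (y : α k) (z : ∀ i : ({k} ∪ J : Finset (Fin n)), α i.1) (w : ∀ i : I, α i.1),
        μ' {ω | (fun i : I => ζ i.1 ω) = w} ≠ 0 →
        μ' {ω | ζ' ω = y ∧ (fun i : ({k} ∪ J : Finset (Fin n)) => ζ i.1 ω) = z
              ∧ (fun i : I => ζ i.1 ω) = w}
            * μ' {ω | (fun i : I => ζ i.1 ω) = w}
          = μ' {ω | ζ' ω = y ∧ (fun i : I => ζ i.1 ω) = w}
            * μ' {ω | (fun i : ({k} ∪ J : Finset (Fin n)) => ζ i.1 ω) = z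
                    ∧ (fun i : I => ζ i.1 ω) = w}) := by
  have : Nonempty Ω := nonempty_of_isProbabilityMeasure μ
  have : Nonempty (α k) := this.map (ξ k)
  have hξ' : Measurable fun ω i => ξ i ω := measurable_pi_lambda _ hξ
  have := Measure.isProbabilityMeasure_map (μ := μ) hξ'.aemeasurable
  set ν := μ.map fun ω i => ξ i ω
  have hX : Measurable fun (a : ∀ i, α i) (i : I) => a i.1 := by fun_prop
  have hY : Measurable fun a : ∀ i, α i => a k := by fun_prop
  refine ⟨(∀ i, α i) × α k, inferInstance, condCopy ν _ hX fun a => a k, inferInstance,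
    fun i p => p.1 i, Prod.snd, by fun_prop, measurable_snd, map_fst_condCopy ν hX, ?_, ?_⟩
  · rw [map_condCopy ν hX hY]
    conv_lhs => rw [← map_fst_condCopy ν hX (Y := fun a => a k)]
    exact Measure.map_map (by fun_prop) measurable_fst
  · intro y z w _
    exact condCopy_mul_eq ν hX (s := {a | (fun i : ({k} ∪ J : Finset (Fin n)) => a i.1) = z})
      (.of_discrete) (measurableSet_singleton y) (measurableSet_singleton w)
end

section
/- (Lemma 2: membership of a point in a projection via duality.) Let A₁ ∈ ℝ^{r×n₁}, A₂ ∈ ℝ^{r×n₂}, B ∈ ℝ^r, and fix x₁ ∈ ℝ^{n₁}. Then there exists x₂ ∈ ℝ^{n₂} with A₁x₁ + A₂x₂ ≥ B if and only if for every y ∈ ℝ^r with y ≥ 0 and A₂ᵀy = 0 one has (B − A₁x₁)·y ≤ 0. -/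
open Matrix

/-- A finite family of lower bounds lying below a finite family of upper bounds leaves room
for a common value. -/
theorem exists_between_finite_families {α β : Type*} [Finite α] [Finite β]
    (f : α → ℝ) (g : β → ℝ) (h : ∀ i j, f i ≤ g j) : ∃ t, (∀ i, f i ≤ t) ∧ ∀ j, t ≤ g j := by
  rcases isEmpty_or_nonempty α with hα | hα
  · obtain ⟨t, ht⟩ := (Set.finite_range g).bddBelow
    exact ⟨t, fun i => hα.elim i, fun j => ht ⟨j, rfl⟩⟩
  · exact ⟨⨆ i, f i, le_ciSup (Set.finite_range f).bddAbove, fun j => ciSup_le fun i => h i j⟩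

/-- Fourier–Motzkin elimination of one variable: finitely many nonnegative combinations of the
inequalities `c i ≤ t * a i`, all cancelling `t`, decide whether the system has a solution `t`. -/
theorem exists_fourier_motzkin_matrix.{u} {ι : Type u} [Fintype ι] (a : ι → ℝ) :
    ∃ (κ : Type u) (_ : Fintype κ) (W : Matrix κ ι ℝ), (∀ k i, 0 ≤ W k i) ∧ W *ᵥ a = 0 ∧
      ∀ c : ι → ℝ, (∀ k, (W *ᵥ c) k ≤ 0) → ∃ t : ℝ, ∀ i, c i ≤ t * a i := by
  classical
  refine ⟨{i // a i = 0} ⊕ {i // 0 < a i} × {i // a i < 0}, inferInstance,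
    Matrix.of (Sum.elim (fun i => Pi.single i.1 1)
      fun p => Pi.single p.1.1 (-a p.2.1) + Pi.single p.2.1 (a p.1.1)), ?_, ?_, ?_⟩
  · rintro (i | ⟨i, j⟩) k
    · exact (Pi.single_nonneg.2 zero_le_one : (0 : ι → ℝ) ≤ Pi.single i.1 1) k
    · exact add_nonneg (Pi.single_nonneg.2 (neg_nonneg.2 j.2.le) : (0 : ι → ℝ) ≤ _)
        (Pi.single_nonneg.2 i.2.le : (0 : ι → ℝ) ≤ _) k
  · ext (i | ⟨i, j⟩)
    · simp [mulVec, i.2]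
    · change (Pi.single i.1 (-a j) + Pi.single j.1 (a i)) ⬝ᵥ a = 0
      rw [add_dotProduct, single_dotProduct, single_dotProduct]
      ring
  · intro c hc
    obtain ⟨t, hpos, hneg⟩ := exists_between_finite_families
      (fun i : {i // 0 < a i} => c i / a i) (fun j : {j // a j < 0} => c j / a j) (by
        intro i j
        have h : (Pi.single i.1 (-a j) + Pi.single j.1 (a i)) ⬝ᵥ c ≤ 0 := hc (.inr (i, j))
        rw [add_dotProduct, single_dotProduct, single_dotProduct] at h
        rw [le_div_iff_of_neg j.2, div_mul_eq_mul_div, le_div_iff₀ i.2]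
        linarith)
    refine ⟨t, fun i => ?_⟩
    rcases lt_trichotomy (a i) 0 with h | h | h
    · exact (le_div_iff_of_neg h).1 (hneg ⟨i, h⟩)
    · simpa [mulVec, h] using hc (.inl ⟨i, h⟩)
    · exact (div_le_iff₀ h).1 (hpos ⟨i, h⟩)

/-- **Farkas' lemma** (Gale's form). -/
theorem exists_le_mulVec_of_forall_dotProduct_nonpos {n : ℕ} {ι : Type*} [Fintype ι]
    (A : Matrix ι (Fin n) ℝ) (b : ι → ℝ)
    (h : ∀ y : ι → ℝ, (∀ i, 0 ≤ y i) → y ᵥ* A = 0 → b ⬝ᵥ y ≤ 0) :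
    ∃ x : Fin n → ℝ, ∀ i, b i ≤ (A *ᵥ x) i := by
  classical
  induction n generalizing ι with
  | zero =>
    refine ⟨0, fun i => ?_⟩
    simpa using h (Pi.single i 1)
      (Pi.single_nonneg.2 zero_le_one : (0 : ι → ℝ) ≤ _) (Subsingleton.elim _ _)
  | succ n ih =>
    obtain ⟨κ, _, W, hW, hWa, hWc⟩ := exists_fourier_motzkin_matrix fun i => A i 0
    obtain ⟨x, hx⟩ := ih (W * A.submatrix id Fin.succ) (W *ᵥ b) (by
      intro z hz hzA
      rw [dotProduct_comm, dotProduct_mulVec, dotProduct_comm]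
      refine h _ (fun i => Finset.sum_nonneg fun k _ => mul_nonneg (hz k) (hW k i)) ?_
      ext j
      refine Fin.cases ?_ (fun j => ?_) j
      · change (z ᵥ* W) ⬝ᵥ (fun i => A i 0) = 0
        rw [← dotProduct_mulVec, hWa, dotProduct_zero]
      · rw [← vecMul_vecMul] at hzA
        exact congrFun hzA j)
    obtain ⟨t, ht⟩ := hWc (b - A.submatrix id Fin.succ *ᵥ x) (fun k => by
      simpa [mulVec_sub] using hx k)
    refine ⟨Fin.cons t x, fun i => ?_⟩
    have hi := ht i
    simp only [Pi.sub_apply, mulVec, dotProduct, submatrix_apply, id] at hi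
    simp only [mulVec, dotProduct, Fin.sum_univ_succ, Fin.cons_zero, Fin.cons_succ]
    linarith

/-- Lemma 2: the point `x₁` lies in the projection of `{(x₁, x₂) : A₁x₁ + A₂x₂ ≥ B}`
if and only if `(B - A₁x₁) ⬝ y ≤ 0` for every `y ≥ 0` with `A₂ᵀy = 0`. -/
theorem membership_in_projection_via_duality {r n₁ n₂ : ℕ}
    (A₁ : Matrix (Fin r) (Fin n₁) ℝ) (A₂ : Matrix (Fin r) (Fin n₂) ℝ)
    (B : Fin r → ℝ) (x₁ : Fin n₁ → ℝ) :
    (∃ x₂ : Fin n₂ → ℝ, ∀ i, B i ≤ (A₁.mulVec x₁ + A₂.mulVec x₂) i) ↔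
    (∀ y : Fin r → ℝ, (∀ i, 0 ≤ y i) → A₂ᵀ.mulVec y = 0 → (B - A₁.mulVec x₁) ⬝ᵥ y ≤ 0) := by
  constructor
  · rintro ⟨x₂, hx⟩ y hy hyA
    rw [mulVec_transpose] at hyA
    calc (B - A₁ *ᵥ x₁) ⬝ᵥ y ≤ (A₂ *ᵥ x₂) ⬝ᵥ y :=
          dotProduct_le_dotProduct_of_nonneg_right (sub_le_iff_le_add'.2 hx) hy
      _ = 0 := by rw [dotProduct_comm, dotProduct_mulVec, hyA, zero_dotProduct]
  · intro h
    obtain ⟨x₂, hx⟩ := exists_le_mulVec_of_forall_dotProduct_nonpos A₂ (B - A₁ *ᵥ x₁)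
      fun y hy hyA => h y hy (by rw [mulVec_transpose, hyA])
    exact ⟨x₂, fun i => sub_le_iff_le_add'.1 (hx i)⟩
end

section
/- (Projection of an H-represented polyhedral cone is an H-represented polyhedral cone.) Let A₁ ∈ ℝ^{r×n₁} and A₂ ∈ ℝ^{r×n₂}. Then there exist s ∈ ℕ and a matrix B ∈ ℝ^{s×n₁} such that {x₁ ∈ ℝ^{n₁} : ∃ x₂ ∈ ℝ^{n₂}, A₁x₁ + A₂x₂ ≥ 0} = {x₁ ∈ ℝ^{n₁} : Bx₁ ≥ 0}. -/
open Matrix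

/-- Finitely many reals lying below finitely many others admit a common separating point. -/
theorem exists_forall_le_and_forall_ge_of_finset {ι : Type*} (P N : Finset ι) (l u : ι → ℝ)
    (h : ∀ i ∈ P, ∀ j ∈ N, l i ≤ u j) :
    ∃ t : ℝ, (∀ i ∈ P, l i ≤ t) ∧ ∀ j ∈ N, t ≤ u j := by
  rcases P.eq_empty_or_nonempty with rfl | hP
  · rcases N.eq_empty_or_nonempty with rfl | hN
    · exact ⟨0, by simp, by simp⟩
    · obtain ⟨j, -, hmin⟩ := N.exists_min_image u hN
      exact ⟨u j, by simp, hmin⟩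
  · obtain ⟨i, hi, hmax⟩ := P.exists_max_image l hP
    exact ⟨l i, hmax, h i hi⟩

/-- Fourier–Motzkin elimination of one real variable from a finite system of homogeneous linear
inequalities. -/
theorem exists_finite_system_eliminating_real {V ι : Type} [AddCommGroup V] [Module ℝ V]
    [Finite ι] (f : ι → V →ₗ[ℝ] ℝ) (c : ι → ℝ) :
    ∃ (κ : Type) (_ : Finite κ) (g : κ → V →ₗ[ℝ] ℝ),
      ∀ x, (∃ t : ℝ, ∀ i, 0 ≤ f i x + c i * t) ↔ ∀ k, 0 ≤ g k x := by
  classical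
  have := Fintype.ofFinite ι
  refine ⟨{i // c i = 0} ⊕ {i // 0 < c i} × {j // c j < 0}, inferInstance,
    Sum.elim (fun i ↦ f i) (fun p ↦ c p.1 • f p.2 - c p.2 • f p.1), fun x ↦ ⟨?_, fun h ↦ ?_⟩⟩
  · rintro ⟨t, ht⟩ (⟨i, hi⟩ | ⟨⟨i, hi⟩, ⟨j, hj⟩⟩)
    · simpa [hi] using ht i
    · have h₁ := mul_nonneg hi.le (ht j)
      have h₂ := mul_nonneg (neg_nonneg.2 hj.le) (ht i)
      simp only [Sum.elim_inr, LinearMap.sub_apply, LinearMap.smul_apply, smul_eq_mul]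
      linarith
  · obtain ⟨t, hl, hu⟩ := exists_forall_le_and_forall_ge_of_finset
      (Finset.univ.filter fun i ↦ 0 < c i) (Finset.univ.filter fun j ↦ c j < 0)
      (fun i ↦ -f i x / c i) (fun j ↦ f j x / -c j) (by
        intro i hi j hj
        rw [Finset.mem_filter_univ] at hi hj
        have hij := h (.inr (⟨i, hi⟩, ⟨j, hj⟩))
        simp only [Sum.elim_inr, LinearMap.sub_apply, LinearMap.smul_apply, smul_eq_mul] at hij
        rw [div_le_div_iff₀ hi (neg_pos.2 hj)]
        linarith)
    refine ⟨t, fun i ↦ ?_⟩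
    rcases lt_trichotomy (c i) 0 with hi | hi | hi
    · have := hu i (by simpa using hi)
      rw [le_div_iff₀ (neg_pos.2 hi)] at this
      linarith
    · simpa [hi] using h (.inl ⟨i, hi⟩)
    · have := hl i (by simpa using hi)
      rw [div_le_iff₀ hi] at this
      linarith

/-- Fourier–Motzkin elimination of finitely many real variables from a finite system of homogeneous
linear inequalities. -/
theorem exists_finite_system_eliminating_fin {n : ℕ} {V ι : Type} [AddCommGroup V] [Module ℝ V]
    [Finite ι] (f : ι → V →ₗ[ℝ] ℝ) (A : Matrix ι (Fin n) ℝ) :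
    ∃ (κ : Type) (_ : Finite κ) (g : κ → V →ₗ[ℝ] ℝ),
      ∀ x, (∃ y : Fin n → ℝ, ∀ i, 0 ≤ f i x + (A *ᵥ y) i) ↔ ∀ k, 0 ≤ g k x := by
  induction n generalizing V with
  | zero => exact ⟨ι, inferInstance, f, fun x ↦ by simp [Matrix.mulVec, dotProduct]⟩
  | succ n ih =>
    obtain ⟨κ, _, g, hg⟩ := ih (V := V × ℝ)
      (fun i ↦ (f i).coprod (A i 0 • LinearMap.id)) (A.submatrix id Fin.succ)
    obtain ⟨κ', hκ', g', hg'⟩ := exists_finite_system_eliminating_real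
      (fun k ↦ g k ∘ₗ LinearMap.inl ℝ V ℝ) (fun k ↦ g k (0, 1))
    refine ⟨κ', hκ', g', fun x ↦ ?_⟩
    have key (t : ℝ) (k : κ) :
        (g k ∘ₗ LinearMap.inl ℝ V ℝ) x + g k (0, 1) * t = g k (x, t) := by
      have h : ((x, t) : V × ℝ) = (x, 0) + t • (0, 1) := by simp
      rw [h, map_add, map_smul, smul_eq_mul, mul_comm t]
      rfl
    simp only [← hg', key, ← hg, Fin.exists_fin_succ_pi]
    simp [Matrix.mulVec, dotProduct, Fin.sum_univ_succ, add_assoc]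

/-- The projection of an H-represented polyhedral cone onto the `x₁`-coordinates is again
an H-represented polyhedral cone. -/
theorem projection_of_polyhedral_cone_is_polyhedral_cone {r n₁ n₂ : ℕ}
    (A₁ : Matrix (Fin r) (Fin n₁) ℝ) (A₂ : Matrix (Fin r) (Fin n₂) ℝ) :
    ∃ (s : ℕ) (B : Matrix (Fin s) (Fin n₁) ℝ),
      {x₁ : Fin n₁ → ℝ | ∃ x₂ : Fin n₂ → ℝ, ∀ i, 0 ≤ (A₁.mulVec x₁ + A₂.mulVec x₂) i}
        = {x₁ : Fin n₁ → ℝ | ∀ j, 0 ≤ B.mulVec x₁ j} := by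
  obtain ⟨κ, _, g, hg⟩ := exists_finite_system_eliminating_fin
    (fun i ↦ LinearMap.proj i ∘ₗ A₁.mulVecLin) A₂
  obtain ⟨s, ⟨e⟩⟩ := Finite.exists_equiv_fin κ
  refine ⟨s, LinearMap.toMatrix' (LinearMap.pi fun j ↦ g (e.symm j)), Set.ext fun x ↦ ?_⟩
  simp only [Set.mem_ofPred_eq, LinearMap.toMatrix'_mulVec, LinearMap.pi_apply]
  exact (hg x).trans e.symm.forall_congr_right.symm
end
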